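/- (Weighted integration by parts for the weight 1+|x-x₀|^{2β}.) Let A = {x ∈ ℝ² : R₂ < |x| < R₁} with 1/2 ≤ R₂ < R₁ ≤ 1, let β ∈ (0,1/2), x₀ ∈ C(1/2), let V ∈ C¹(closure(A)) and u ∈ C¹(closure(A)). Then ∫_A −(1+|x-x₀|^{2β}) V(x) [(x-x₀)·∇(e^{u})(x)] dx = ∫_A (2 + 2(β+1)|x-x₀|^{2β}) V(x) e^{u(x)} dx + ∫_A (1+|x-x₀|^{2β}) [(x-x₀)·∇V(x)] e^{u(x)} dx − ∫_{∂A} (1+|x-x₀|^{2β}) [(x-x₀)·ν(x)] V(x) e^{u(x)} dσ(x), where ν is the outward unit normal of A and dσ is arc-length measure on ∂A. -/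

import Mathlib

open MeasureTheory Real RealInnerProductSpace

noncomputable section

/-- The Euclidean plane ℝ². -/
abbrev E2 := EuclideanSpace ℝ (Fin 2)

/-- The open annulus `{x : R₂ < |x| < R₁}` centered at the origin. -/
def ann (R₂ R₁ : ℝ) : Set E2 := {x : E2 | R₂ < ‖x‖ ∧ ‖x‖ < R₁}

/-- `Ω`, the open annulus of radii 1/2 and 1 centered at the origin. -/
def Omega : Set E2 := ann (1/2) 1

/-- The Laplacian `Δ = ∂₁₁ + ∂₂₂` on ℝ². -/
def lap (u : E2 → ℝ) (x : E2) : ℝ :=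
  ∑ i : Fin 2,
    iteratedFDeriv ℝ 2 u x ![EuclideanSpace.single i 1, EuclideanSpace.single i 1]

/-- The point `r (cos θ, sin θ)` on the circle of radius `r`. -/
def circlePt (r θ : ℝ) : E2 :=
  (WithLp.equiv 2 (Fin 2 → ℝ)).symm ![r * Real.cos θ, r * Real.sin θ]

/-- Arc-length integral of `f` over the circle `C(r) = {x : |x| = r}` centered at the origin:
`∫_{C(r)} f dσ = ∫_0^{2π} f(r cos θ, r sin θ) r dθ`. -/
def circleIntR (f : E2 → ℝ) (r : ℝ) : ℝ := ∫ θ in (0:ℝ)..(2 * π), f (circlePt r θ) * r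

/-- A classical solution of problem (P): `u ∈ C²(closure Ω)`, `u = 0` on `∂Ω`, and
`-Δu = (1 + |x - x₀|^{2β}) V e^u` in `Ω`. -/
def IsSolP (β : ℝ) (x₀ : E2) (V u : E2 → ℝ) : Prop :=
  ContDiffOn ℝ 2 u (closure Omega) ∧
  (∀ x ∈ frontier Omega, u x = 0) ∧
  ∀ x ∈ Omega, -lap u x = (1 + ‖x - x₀‖ ^ (2 * β)) * V x * Real.exp (u x)

/-- A classical solution of problem (P_β): `u ∈ C²(closure Ω)`, `u = 0` on `∂Ω`, and
`-Δu = |x - x₀|^{2β} V e^u` in `Ω`. -/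
def IsSolPbeta (β : ℝ) (x₀ : E2) (V u : E2 → ℝ) : Prop :=
  ContDiffOn ℝ 2 u (closure Omega) ∧
  (∀ x ∈ frontier Omega, u x = 0) ∧
  ∀ x ∈ Omega, -lap u x = ‖x - x₀‖ ^ (2 * β) * V x * Real.exp (u x)


open Set Metric in
theorem polar_ann (R₂ R₁ : ℝ) (h0 : 0 < R₂) (f : E2 → ℝ) :
    ∫ x in ann R₂ R₁, f x = ∫ p in Ioo R₂ R₁ ×ˢ Ioo (-π) π, p.1 * f (circlePt p.1 p.2) := by
  have hm : MeasurableSet (ann R₂ R₁) := by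
    unfold ann
    exact (measurableSet_lt measurable_const measurable_norm).inter
      (measurableSet_lt measurable_norm measurable_const)
  rw [← integral_indicator hm]
  have e1 := (EuclideanSpace.volume_preserving_symm_measurableEquiv_toLp (Fin 2)).symm
  rw [← (EuclideanSpace.volume_preserving_symm_measurableEquiv_toLp (Fin 2)).symm.integral_comp
    (MeasurableEquiv.measurableEmbedding _)]
  rw [← (volume_preserving_finTwoArrow ℝ).symm.integral_comp
    (MeasurableEquiv.measurableEmbedding _)]
  rw [← integral_comp_polarCoord_symm]
  have hnorm : ∀ p : ℝ × ℝ, 0 < p.1 → ‖circlePt p.1 p.2‖ = p.1 := by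
    intro p hp
    rw [EuclideanSpace.norm_eq]
    simp only [circlePt, Fin.sum_univ_two]
    simp only [WithLp.equiv_symm_apply, Matrix.cons_val_zero, Matrix.cons_val_one, norm_eq_abs, sq_abs]
    rw [Real.sqrt_eq_iff_mul_self_eq (by positivity) hp.le]
    nlinarith [Real.sin_sq_add_cos_sq p.2]
  have hms : MeasurableSet (Ioo R₂ R₁ ×ˢ Ioo (-π) π) := measurableSet_Ioo.prod measurableSet_Ioo
  have hmt : MeasurableSet polarCoord.target := polarCoord.open_target.measurableSet
  have hsub : Ioo R₂ R₁ ×ˢ Ioo (-π) π ⊆ polarCoord.target := by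
    rintro p ⟨h1, h2⟩
    exact ⟨h0.trans h1.1, h2⟩
  rw [← integral_indicator hms, ← integral_indicator hmt]
  congr 1
  ext p
  by_cases hp : p ∈ polarCoord.target
  · rw [indicator_of_mem hp]
    have hC : (MeasurableEquiv.toLp 2 (Fin 2 → ℝ)).symm.symm
        (MeasurableEquiv.finTwoArrow.symm (polarCoord.symm p)) = circlePt p.1 p.2 := by
      rfl
    have hpos : 0 < p.1 := hp.1
    rw [hC]
    by_cases hs : p ∈ Ioo R₂ R₁ ×ˢ Ioo (-π) π
    · rw [indicator_of_mem hs, indicator_of_mem, smul_eq_mul]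
      simp only [ann, mem_ofPred_eq, hnorm p hpos]
      exact hs.1
    · rw [indicator_of_notMem hs, indicator_of_notMem, smul_zero]
      simp only [ann, mem_ofPred_eq, hnorm p hpos]
      exact fun h => hs ⟨h, hp.2⟩
  · rw [indicator_of_notMem hp, indicator_of_notMem (fun h => hp (hsub h))]

theorem norm_circlePt (r θ : ℝ) (hr : 0 ≤ r) : ‖circlePt r θ‖ = r := by
  rw [EuclideanSpace.norm_eq]
  simp only [circlePt, Fin.sum_univ_two]
  simp only [WithLp.equiv_symm_apply, Matrix.cons_val_zero, Matrix.cons_val_one, norm_eq_abs, sq_abs]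
  rw [Real.sqrt_eq_iff_mul_self_eq (by positivity) hr]
  nlinarith [Real.sin_sq_add_cos_sq θ]

/-- angular unit vector -/
def eT (θ : ℝ) : E2 := !₂[-Real.sin θ, Real.cos θ]

theorem circlePt_eq (r θ : ℝ) : circlePt r θ = r • circlePt 1 θ := by
  ext i; fin_cases i <;> simp [circlePt]

theorem hasDerivAt_circlePt_one (θ : ℝ) : HasDerivAt (circlePt 1) (eT θ) θ := by
  have : HasDerivAt (fun t => (PiLp.continuousLinearEquiv 2 ℝ (fun _ : Fin 2 => ℝ)).symm
      ![Real.cos t, Real.sin t])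
      ((PiLp.continuousLinearEquiv 2 ℝ (fun _ : Fin 2 => ℝ)).symm ![-Real.sin θ, Real.cos θ]) θ := by
    apply HasFDerivAt.comp_hasDerivAt (l := (PiLp.continuousLinearEquiv 2 ℝ (fun _ : Fin 2 => ℝ)).symm)
      (f := fun t => ![Real.cos t, Real.sin t])
      (l' := ((PiLp.continuousLinearEquiv 2 ℝ (fun _ : Fin 2 => ℝ)).symm :
        (Fin 2 → ℝ) →L[ℝ] PiLp 2 (fun _ : Fin 2 => ℝ)))
    · exact (PiLp.continuousLinearEquiv 2 ℝ (fun _ : Fin 2 => ℝ)).symm.hasFDerivAt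
    · rw [hasDerivAt_pi]
      intro i
      fin_cases i
      · exact Real.hasDerivAt_cos θ
      · exact Real.hasDerivAt_sin θ
  have e : circlePt 1 = (fun t => (PiLp.continuousLinearEquiv 2 ℝ (fun _ : Fin 2 => ℝ)).symm
      ![Real.cos t, Real.sin t]) := by
    ext t i; fin_cases i <;> simp [circlePt]
  rw [e]
  exact this

/-- derivative of polar coordinates -/
def Lc (p : ℝ × ℝ) : ℝ × ℝ →L[ℝ] E2 :=
  p.1 • (ContinuousLinearMap.snd ℝ ℝ ℝ).smulRight (eT p.2)
    + (ContinuousLinearMap.fst ℝ ℝ ℝ).smulRight (circlePt 1 p.2)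

theorem hasFDerivAt_circlePt (p : ℝ × ℝ) :
    HasFDerivAt (fun p : ℝ × ℝ => circlePt p.1 p.2) (Lc p) p := by
  have h1 : HasFDerivAt (fun p : ℝ × ℝ => circlePt 1 p.2)
      ((ContinuousLinearMap.snd ℝ ℝ ℝ).smulRight (eT p.2)) p := by
    have := (hasDerivAt_circlePt_one p.2).hasFDerivAt.comp p (hasFDerivAt_snd (𝕜 := ℝ))
    refine this.congr_fderiv ?_
    ext <;> simp
  have h2 : HasFDerivAt (fun p : ℝ × ℝ => p.1) (ContinuousLinearMap.fst ℝ ℝ ℝ) p := hasFDerivAt_fst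
  have := h2.smul h1
  rw [funext (fun p : ℝ × ℝ => circlePt_eq p.1 p.2)]
  exact this

theorem continuous_circlePt : Continuous (fun p : ℝ × ℝ => circlePt p.1 p.2) :=
  continuous_iff_continuousAt.2 fun p => (hasFDerivAt_circlePt p).continuousAt

theorem vec_id (r θ : ℝ) (x₀ : E2) :
    (r - x₀ 0 * Real.cos θ - x₀ 1 * Real.sin θ) • circlePt 1 θ
      + (x₀ 0 * Real.sin θ - x₀ 1 * Real.cos θ) • eT θ = circlePt r θ - x₀ := by
  have := Real.sin_sq_add_cos_sq θ
  ext i; fin_cases i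
  · simp [circlePt, eT]
    linear_combination (-x₀ 0) * this
  · simp [circlePt, eT]
    linear_combination (-x₀ 1) * this

theorem inner_circle (r θ : ℝ) (x₀ : E2) :
    ⟪circlePt r θ - x₀, circlePt 1 θ⟫ = r - x₀ 0 * Real.cos θ - x₀ 1 * Real.sin θ := by
  have := Real.sin_sq_add_cos_sq θ
  simp [circlePt, PiLp.inner_apply, Fin.sum_univ_two]
  linear_combination r * this

/-- closed annulus -/
def cann (R₂ R₁ : ℝ) : Set E2 := {x : E2 | R₂ ≤ ‖x‖ ∧ ‖x‖ ≤ R₁}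

open Set Metric in
theorem cann_ball (R₂ R₁ : ℝ) (h0 : 0 < R₂) (hR : R₂ < R₁) (x : E2) (hx : x ∈ cann R₂ R₁) :
    ∃ c d, 0 < d ∧ x ∈ closedBall c d ∧ closedBall c d ⊆ cann R₂ R₁ ∧ ball c d ⊆ ann R₂ R₁ := by
  obtain ⟨h1, h2⟩ := hx
  have hx0 : 0 < ‖x‖ := h0.trans_le h1
  set m := (R₁ + R₂) / 2 with hm
  have hc : ‖(m / ‖x‖) • x‖ = m := by
    rw [norm_smul, norm_div, norm_norm, div_mul_cancel₀ _ hx0.ne', Real.norm_of_nonneg]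
    rw [hm]; linarith
  refine ⟨(m / ‖x‖) • x, (R₁ - R₂) / 2, by linarith, ?_, ?_, ?_⟩
  · rw [mem_closedBall, dist_eq_norm]
    have : x - (m / ‖x‖) • x = (1 - m / ‖x‖) • x := by rw [sub_smul, one_smul]
    rw [this, norm_smul, norm_eq_abs]
    nth_rewrite 2 [← abs_of_pos hx0]
    rw [← abs_mul, sub_mul, div_mul_cancel₀ _ hx0.ne', abs_le]
    constructor <;> linarith
  · intro y hy
    rw [mem_closedBall, dist_eq_norm] at hy
    have := abs_le.1 ((abs_norm_sub_norm_le y ((m / ‖x‖) • x)).trans hy)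
    rw [hc] at this
    constructor <;> linarith
  · intro y hy
    rw [mem_ball, dist_eq_norm] at hy
    have := abs_lt.1 ((abs_norm_sub_norm_le y ((m / ‖x‖) • x)).trans_lt hy)
    rw [hc] at this
    constructor <;> linarith

open Set Metric in
theorem cann_uniqueDiff (R₂ R₁ : ℝ) (h0 : 0 < R₂) (hR : R₂ < R₁) :
    UniqueDiffOn ℝ (cann R₂ R₁) := by
  intro x hx
  obtain ⟨c, d, hd, hxb, hs, -⟩ := cann_ball R₂ R₁ h0 hR x hx
  refine UniqueDiffWithinAt.mono (uniqueDiffOn_convex (convex_closedBall c d) ?_ x hxb) hs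
  exact ⟨c, ball_subset_interior_closedBall (mem_ball_self hd)⟩

open Set Metric in
theorem cann_sub_closure (R₂ R₁ : ℝ) (h0 : 0 < R₂) (hR : R₂ < R₁) :
    cann R₂ R₁ ⊆ closure (ann R₂ R₁) := by
  intro x hx
  obtain ⟨c, d, hd, hxb, -, hs⟩ := cann_ball R₂ R₁ h0 hR x hx
  rw [← closure_ball c hd.ne'] at hxb
  exact closure_mono hs hxb

theorem isOpen_ann (R₂ R₁ : ℝ) : IsOpen (ann R₂ R₁) :=
  (isOpen_lt continuous_const continuous_norm).inter (isOpen_lt continuous_norm continuous_const)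

theorem ann_sub_cann (R₂ R₁ : ℝ) : ann R₂ R₁ ⊆ cann R₂ R₁ := fun _ h => ⟨h.1.le, h.2.le⟩

theorem isCompact_cann (R₂ R₁ : ℝ) : IsCompact (cann R₂ R₁) := by
  apply Metric.isCompact_of_isClosed_isBounded
  · exact (isClosed_le continuous_const continuous_norm).inter
      (isClosed_le continuous_norm continuous_const)
  · exact (Metric.isBounded_closedBall (x := (0:E2)) (r := R₁)).subset fun x hx => by
      simpa using hx.2

open Set in
theorem div_ann (R₂ R₁ : ℝ) (h0 : 0 < R₂) (hR : R₂ < R₁) (x₀ : E2) (φ : E2 → ℝ)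
    (φ' : E2 → E2 →L[ℝ] ℝ) (hc : ContinuousOn φ (cann R₂ R₁))
    (hd : ∀ x ∈ ann R₂ R₁, HasFDerivAt φ (φ' x) x)
    (hc' : ContinuousOn (fun x => φ' x (x - x₀)) (cann R₂ R₁)) :
    ∫ x in ann R₂ R₁, (2 * φ x + φ' x (x - x₀)) =
      circleIntR (fun x => φ x * ⟪x - x₀, R₁⁻¹ • x⟫) R₁
      + circleIntR (fun x => φ x * ⟪x - x₀, -(R₂⁻¹ • x)⟫) R₂ := by
  have h01 : 0 < R₁ := h0.trans hR
  have hle : ((R₂, -π) : ℝ × ℝ) ≤ (R₁, π) := ⟨hR.le, by simpa using by linarith [Real.pi_pos]⟩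
  have hmap : MapsTo (fun p : ℝ × ℝ => circlePt p.1 p.2) (Icc (R₂, -π) (R₁, π)) (cann R₂ R₁) := by
    intro p hp
    have h1 : R₂ ≤ p.1 := hp.1.1
    have h2 : p.1 ≤ R₁ := hp.2.1
    simp only [cann, mem_ofPred_eq, norm_circlePt p.1 p.2 (h0.le.trans h1)]
    exact ⟨h1, h2⟩
  have hmap' : ∀ p ∈ Ioo R₂ R₁ ×ˢ Ioo (-π) π, circlePt p.1 p.2 ∈ ann R₂ R₁ := by
    rintro p ⟨hp, -⟩
    simp only [ann, mem_ofPred_eq, norm_circlePt p.1 p.2 (h0.le.trans hp.1.le)]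
    exact hp
  have hΦ : ContinuousOn (fun p : ℝ × ℝ => φ (circlePt p.1 p.2)) (Icc (R₂, -π) (R₁, π)) :=
    hc.comp continuous_circlePt.continuousOn hmap
  have hΦ' : ContinuousOn (fun p : ℝ × ℝ => φ' (circlePt p.1 p.2) (circlePt p.1 p.2 - x₀))
      (Icc (R₂, -π) (R₁, π)) :=
    hc'.comp continuous_circlePt.continuousOn hmap
  set h : ℝ × ℝ → ℝ := fun p => p.1 - x₀ 0 * Real.cos p.2 - x₀ 1 * Real.sin p.2 with hh
  set k : ℝ × ℝ → ℝ := fun p => x₀ 0 * Real.sin p.2 - x₀ 1 * Real.cos p.2 with hk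
  have hhd : ∀ p, HasFDerivAt h (ContinuousLinearMap.fst ℝ ℝ ℝ
      + (k p) • ContinuousLinearMap.snd ℝ ℝ ℝ) p := by
    intro p
    have hs : HasFDerivAt (fun p : ℝ × ℝ => p.2) (ContinuousLinearMap.snd ℝ ℝ ℝ) p := hasFDerivAt_snd
    have hf : HasFDerivAt (fun p : ℝ × ℝ => p.1) (ContinuousLinearMap.fst ℝ ℝ ℝ) p := hasFDerivAt_fst
    have := (hf.sub (hs.cos.const_mul (x₀ 0))).sub (hs.sin.const_mul (x₀ 1))
    refine this.congr_fderiv ?_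
    ext <;> simp [hk]
  have hkd : ∀ p, HasFDerivAt k ((x₀ 0 * Real.cos p.2 + x₀ 1 * Real.sin p.2) •
      ContinuousLinearMap.snd ℝ ℝ ℝ) p := by
    intro p
    have hs : HasFDerivAt (fun p : ℝ × ℝ => p.2) (ContinuousLinearMap.snd ℝ ℝ ℝ) p := hasFDerivAt_snd
    have := (hs.sin.const_mul (x₀ 0)).sub (hs.cos.const_mul (x₀ 1))
    refine this.congr_fderiv ?_
    ext <;> simp
  have hhc : Continuous h := by fun_prop
  have hkc : Continuous k := by fun_prop
  have hΦd : ∀ p ∈ Ioo R₂ R₁ ×ˢ Ioo (-π) π, HasFDerivAt (fun p : ℝ × ℝ => φ (circlePt p.1 p.2))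
      ((φ' (circlePt p.1 p.2)).comp (Lc p)) p := fun p hp =>
    (hd _ (hmap' p hp)).comp p (hasFDerivAt_circlePt p)
  let f' : ℝ × ℝ → ℝ × ℝ →L[ℝ] ℝ := fun p =>
    (p.1 * φ (circlePt p.1 p.2)) • (ContinuousLinearMap.fst ℝ ℝ ℝ
      + (k p) • ContinuousLinearMap.snd ℝ ℝ ℝ)
    + h p • (p.1 • ((φ' (circlePt p.1 p.2)).comp (Lc p))
      + φ (circlePt p.1 p.2) • ContinuousLinearMap.fst ℝ ℝ ℝ)
  let g' : ℝ × ℝ → ℝ × ℝ →L[ℝ] ℝ := fun p =>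
    φ (circlePt p.1 p.2) • ((x₀ 0 * Real.cos p.2 + x₀ 1 * Real.sin p.2) •
      ContinuousLinearMap.snd ℝ ℝ ℝ) + k p • ((φ' (circlePt p.1 p.2)).comp (Lc p))
  have hsum : ∀ p, f' p (1, 0) + g' p (0, 1) =
      p.1 * (2 * φ (circlePt p.1 p.2) + φ' (circlePt p.1 p.2) (circlePt p.1 p.2 - x₀)) := by
    intro p
    rw [← vec_id p.1 p.2 x₀]
    simp only [f', g', Lc, hh, hk]
    simp
    ring
  have hint : ContinuousOn (fun p => f' p (1, 0) + g' p (0, 1)) (Icc (R₂, -π) (R₁, π)) := by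
    simp_rw [hsum]
    exact continuous_fst.continuousOn.mul ((continuousOn_const.mul hΦ).add hΦ')
  have key := integral_divergence_prod_Icc_of_hasFDerivAt_of_le
    (fun p => p.1 * φ (circlePt p.1 p.2) * h p) (fun p => φ (circlePt p.1 p.2) * k p)
    f' g' (R₂, -π) (R₁, π) hle
    ((continuous_fst.continuousOn.mul hΦ).mul hhc.continuousOn)
    (hΦ.mul hkc.continuousOn)
    (fun p hp => (hasFDerivAt_fst.mul (hΦd p hp)).mul (hhd p))
    (fun p hp => (hΦd p hp).mul (hkd p))
    (hint.integrableOn_compact isCompact_Icc)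
  have hper : ∀ r θ, circlePt r (θ + 2 * π) = circlePt r θ := by
    intro r θ; simp [circlePt]
  have hπ : ∀ r, circlePt r π = circlePt r (-π) := by
    intro r; simp [circlePt]
  rw [polar_ann R₂ R₁ h0]
  have hset : ∫ p in Ioo R₂ R₁ ×ˢ Ioo (-π) π, p.1 * (2 * φ (circlePt p.1 p.2)
      + φ' (circlePt p.1 p.2) (circlePt p.1 p.2 - x₀)) =
      ∫ p in Icc (R₂, -π) (R₁, π), f' p (1, 0) + g' p (0, 1) := by
    simp_rw [hsum]
    apply setIntegral_congr_set
    rw [← Icc_prod_Icc]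
    exact Measure.set_prod_ae_eq Ioo_ae_eq_Icc Ioo_ae_eq_Icc
  rw [hset, key]
  have hcirc : ∀ F : E2 → ℝ, ∀ r, circleIntR F r = ∫ θ in (-π)..π, F (circlePt r θ) * r := by
    intro F r
    have hp : Function.Periodic (fun θ => F (circlePt r θ) * r) (2 * π) := by
      intro θ; simp only [hper]
    have := hp.intervalIntegral_add_eq 0 (-π)
    rw [circleIntR]
    rw [zero_add] at this
    rw [this]
    congr 1; ring
  rw [hcirc, hcirc]
  simp only [hk, hπ, Real.sin_pi, Real.cos_pi, Real.sin_neg, Real.cos_neg, neg_zero, sub_self,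
    zero_add]
  rw [sub_eq_add_neg, ← intervalIntegral.integral_neg]
  congr 1
  · congr 1; ext θ
    have : R₁⁻¹ • circlePt R₁ θ = circlePt 1 θ := by
      rw [circlePt_eq R₁, smul_smul, inv_mul_cancel₀ h01.ne', one_smul]
    rw [this, inner_circle]
    ring
  · congr 1; ext θ
    have : R₂⁻¹ • circlePt R₂ θ = circlePt 1 θ := by
      rw [circlePt_eq R₂, smul_smul, inv_mul_cancel₀ h0.ne', one_smul]
    rw [this, inner_neg_right, inner_circle]
    ring

/-- **Weighted integration by parts for the weight `1 + |x - x₀|^{2β}`** on a sub-annulus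
`A = {R₂ < |x| < R₁}` with `1/2 ≤ R₂ < R₁ ≤ 1`, `β ∈ (0, 1/2)`, `x₀ ∈ C(1/2)`. -/
theorem weighted_int_by_parts_P (R₂ R₁ β : ℝ) (hR₂ : 1/2 ≤ R₂) (hR : R₂ < R₁) (hR₁ : R₁ ≤ 1)
    (hβ : 0 < β ∧ β < 1/2) (x₀ : E2) (hx₀ : ‖x₀‖ = 1/2)
    (V u : E2 → ℝ)
    (hV : ContDiffOn ℝ 1 V (closure (ann R₂ R₁)))
    (hu : ContDiffOn ℝ 1 u (closure (ann R₂ R₁))) :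
    ∫ x in ann R₂ R₁,
        -((1 + ‖x - x₀‖ ^ (2 * β)) * V x *
          ⟪x - x₀, gradient (fun y => Real.exp (u y)) x⟫) =
      (∫ x in ann R₂ R₁,
        (2 + 2 * (β + 1) * ‖x - x₀‖ ^ (2 * β)) * V x * Real.exp (u x))
      + (∫ x in ann R₂ R₁,
        (1 + ‖x - x₀‖ ^ (2 * β)) * ⟪x - x₀, gradient V x⟫ * Real.exp (u x))
      - (circleIntR (fun x =>
          (1 + ‖x - x₀‖ ^ (2 * β)) * ⟪x - x₀, R₁⁻¹ • x⟫ * V x * Real.exp (u x)) R₁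
        + circleIntR (fun x =>
          (1 + ‖x - x₀‖ ^ (2 * β)) * ⟪x - x₀, -(R₂⁻¹ • x)⟫ * V x * Real.exp (u x)) R₂) := by
  have h0 : 0 < R₂ := by linarith
  obtain ⟨hβ0, -⟩ := hβ
  set K := cann R₂ R₁ with hK
  have hsub := cann_sub_closure R₂ R₁ h0 hR
  have hVK : ContDiffOn ℝ 1 V K := hV.mono hsub
  have huK : ContDiffOn ℝ 1 u K := hu.mono hsub
  have hUD : UniqueDiffOn ℝ K := cann_uniqueDiff R₂ R₁ h0 hR
  set V' := fderivWithin ℝ V K with hV'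
  set u' := fderivWithin ℝ u K with hu'
  have cV := hVK.continuousOn
  have cu := huK.continuousOn
  have cV' : ContinuousOn V' K := hVK.continuousOn_fderivWithin hUD le_rfl
  have cu' : ContinuousOn u' K := huK.continuousOn_fderivWithin hUD le_rfl
  have hnhds : ∀ x ∈ ann R₂ R₁, K ∈ nhds x := fun x hx =>
    Filter.mem_of_superset ((isOpen_ann R₂ R₁).mem_nhds hx) (ann_sub_cann R₂ R₁)
  have dV : ∀ x ∈ ann R₂ R₁, HasFDerivAt V (V' x) x := fun x hx =>
    (((hVK.differentiableOn one_ne_zero) x (ann_sub_cann R₂ R₁ hx)).hasFDerivWithinAt).hasFDerivAt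
      (hnhds x hx)
  have du : ∀ x ∈ ann R₂ R₁, HasFDerivAt u (u' x) x := fun x hx =>
    (((huK.differentiableOn one_ne_zero) x (ann_sub_cann R₂ R₁ hx)).hasFDerivWithinAt).hasFDerivAt
      (hnhds x hx)
  have cy : Continuous (fun x : E2 => x - x₀) := by fun_prop
  have cN : Continuous (fun x : E2 => ‖x - x₀‖ ^ (2 * β)) :=
    cy.norm.rpow_const (fun x => Or.inr (by linarith))
  have cE : ContinuousOn (fun x => Real.exp (u x)) K := Real.continuous_exp.comp_continuousOn cu
  have cVy : ContinuousOn (fun x => V' x (x - x₀)) K := cV'.clm_apply cy.continuousOn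
  have cuy : ContinuousOn (fun x => u' x (x - x₀)) K := cu'.clm_apply cy.continuousOn
  let w' : E2 → E2 →L[ℝ] ℝ := fun x => ((2 * β) * ‖x - x₀‖ ^ (2 * β - 2)) • innerSL ℝ (x - x₀)
  have hw'y : ∀ x, w' x (x - x₀) = 2 * β * ‖x - x₀‖ ^ (2 * β) := by
    intro x
    simp only [w', _root_.smul_apply, innerSL_apply_apply, smul_eq_mul,
      real_inner_self_eq_norm_sq]
    rcases eq_or_ne (‖x - x₀‖) 0 with h | h
    · rw [h, Real.zero_rpow (by linarith : 2 * β ≠ 0)]; simp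
    · have hp : 0 < ‖x - x₀‖ := lt_of_le_of_ne (norm_nonneg _) h.symm
      rw [mul_assoc, ← Real.rpow_natCast (‖x - x₀‖) 2, ← Real.rpow_add hp]
      norm_num
  have dw : ∀ x ∈ ann R₂ R₁, HasFDerivAt (fun x => 1 + ‖x - x₀‖ ^ (2 * β)) (w' x) x := by
    intro x hx
    have hne : x - x₀ ≠ 0 := by
      intro h
      rw [sub_eq_zero] at h
      have := hx.1
      rw [h, hx₀] at this
      linarith
    have hp : 0 < ‖x - x₀‖ := norm_pos_iff.2 hne
    have hsq : HasFDerivAt (fun x : E2 => ‖x - x₀‖ ^ 2) (2 • innerSL ℝ (x - x₀)) x := by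
      have := ((hasFDerivAt_id x).sub_const x₀).norm_sq
      refine this.congr_fderiv ?_
      ext; simp
    have h1 := (hsq.rpow_const (p := β) (Or.inl (by positivity))).const_add 1
    have e : ∀ y : E2, (‖y - x₀‖ ^ 2) ^ β = ‖y - x₀‖ ^ (2 * β) := by
      intro y
      rw [← Real.rpow_natCast, ← Real.rpow_mul (norm_nonneg _)]; norm_num
    simp only [e] at h1
    refine h1.congr_fderiv ?_
    have e2 : (‖x - x₀‖ ^ 2) ^ (β - 1) = ‖x - x₀‖ ^ (2 * β - 2) := by
      rw [← Real.rpow_natCast, ← Real.rpow_mul (norm_nonneg _)]; congr 1; push_cast; ring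
    rw [e2]
    ext v
    simp [w']
    ring
  have key := div_ann R₂ R₁ h0 hR x₀
    (fun x => (1 + ‖x - x₀‖ ^ (2 * β)) * (V x * Real.exp (u x)))
    (fun x => (1 + ‖x - x₀‖ ^ (2 * β)) • (V x • (Real.exp (u x) • u' x) + Real.exp (u x) • V' x)
      + (V x * Real.exp (u x)) • w' x)
    ((continuous_const.add cN).continuousOn.mul (cV.mul cE))
    (fun x hx => (dw x hx).mul ((dV x hx).mul (du x hx).exp))
    (by
      simp only [_root_.add_apply, _root_.smul_apply, smul_eq_mul, hw'y]
      exact ((continuous_const.add cN).continuousOn.mul ((cV.mul (cE.mul cuy)).add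
        (cE.mul cVy))).add ((cV.mul cE).mul (continuous_const.mul cN).continuousOn))
  have int : ∀ f : E2 → ℝ, ContinuousOn f K → IntegrableOn f (ann R₂ R₁) := fun f hf =>
    (hf.integrableOn_compact (isCompact_cann R₂ R₁)).mono_set (ann_sub_cann R₂ R₁)
  have hm := (isOpen_ann R₂ R₁).measurableSet
  have hgrad : ∀ (f : E2 → ℝ) (f' : E2 →L[ℝ] ℝ) x, HasFDerivAt f f' x →
      ⟪x - x₀, gradient f x⟫ = f' (x - x₀) := by
    intro f f' x hf
    rw [gradient, hf.fderiv, real_inner_comm, InnerProductSpace.toDual_symm_apply]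
  have I1 : ∫ x in ann R₂ R₁, -((1 + ‖x - x₀‖ ^ (2 * β)) * V x *
          ⟪x - x₀, gradient (fun y => Real.exp (u y)) x⟫) =
      ∫ x in ann R₂ R₁, -((1 + ‖x - x₀‖ ^ (2 * β)) * V x * (Real.exp (u x) * u' x (x - x₀))) := by
    refine setIntegral_congr_fun hm fun x hx => ?_
    rw [hgrad _ _ x (du x hx).exp]
    simp
  have I2 : ∫ x in ann R₂ R₁, (1 + ‖x - x₀‖ ^ (2 * β)) * ⟪x - x₀, gradient V x⟫ * Real.exp (u x) =
      ∫ x in ann R₂ R₁, (1 + ‖x - x₀‖ ^ (2 * β)) * V' x (x - x₀) * Real.exp (u x) := by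
    refine setIntegral_congr_fun hm fun x hx => ?_
    rw [hgrad _ _ x (dV x hx)]
  have cW : ContinuousOn (fun x : E2 => 1 + ‖x - x₀‖ ^ (2 * β)) K :=
    (continuous_const.add cN).continuousOn
  have i1 := int (fun x => (1 + ‖x - x₀‖ ^ (2 * β)) * V x * (Real.exp (u x) * u' x (x - x₀)))
    ((cW.mul cV).mul (cE.mul cuy))
  have i2 := int (fun x => (1 + ‖x - x₀‖ ^ (2 * β)) * V' x (x - x₀) * Real.exp (u x))
    ((cW.mul cVy).mul cE)
  have i3 := int (fun x => (2 + 2 * (β + 1) * ‖x - x₀‖ ^ (2 * β)) * V x * Real.exp (u x))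
    (((continuous_const.add (continuous_const.mul cN)).continuousOn.mul cV).mul cE)
  have c1 : ∀ (n : E2 → E2), (fun x => (1 + ‖x - x₀‖ ^ (2 * β)) * (V x * Real.exp (u x))
      * ⟪x - x₀, n x⟫) = (fun x =>
          (1 + ‖x - x₀‖ ^ (2 * β)) * ⟪x - x₀, n x⟫ * V x * Real.exp (u x)) := by
    intro n; ext x; ring
  rw [c1 (fun x => R₁⁻¹ • x), c1 (fun x => -(R₂⁻¹ • x))] at key
  rw [I1, I2, ← key, integral_neg, ← integral_add i3 i2, eq_sub_iff_add_eq, neg_add_eq_iff_eq_add]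
  refine Eq.trans ?_ (integral_add i1 (i3.add i2))
  refine setIntegral_congr_fun hm fun x hx => ?_
  simp only [_root_.add_apply, _root_.smul_apply, smul_eq_mul, hw'y,
    Pi.add_apply]
  ring
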